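/- For every a = (a₁,a₂,a₃,a₄) ∈ ℂ⁴ and every v = (v₁,v₂,v₃) ∈ ℂ³ with f(a,v) = 0, the image τ₃(v) also satisfies f(a, τ₃(v)) = 0; that is, the braid-group generator τ₃ maps the relative character variety M_a = {v ∈ ℂ³ : f(a,v) = 0} into itself. -/

import Mathlib

/-- The Fricke-type polynomial cutting out the relative character variety. -/
def fpoly (a1 a2 a3 a4 : ℂ) (v : ℂ × ℂ × ℂ) : ℂ :=
  v.1 ^ 2 + v.2.1 ^ 2 + v.2.2 ^ 2 + v.1 * v.2.1 * v.2.2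
    - (a1 * a2 + a3 * a4) * v.1 - (a1 * a4 + a2 * a3) * v.2.1
    - (a1 * a3 + a2 * a4) * v.2.2
    + (a1 ^ 2 + a2 ^ 2 + a3 ^ 2 + a4 ^ 2 + a1 * a2 * a3 * a4 - 4)

/-- The braid group generator τ₁ acting on trace coordinates. -/
def tau1 (a1 a2 a3 a4 : ℂ) (v : ℂ × ℂ × ℂ) : ℂ × ℂ × ℂ :=
  (v.1,
   a1 * a4 + a2 * a3 - v.1 * (a1 * a3 + a2 * a4 - v.1 * v.2.1 - v.2.2) - v.2.1,
   a1 * a3 + a2 * a4 - v.1 * v.2.1 - v.2.2)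

/-- The braid group generator τ₂ acting on trace coordinates. -/
def tau2 (a1 a2 a3 a4 : ℂ) (v : ℂ × ℂ × ℂ) : ℂ × ℂ × ℂ :=
  (a1 * a2 + a3 * a4 - v.2.1 * v.2.2 - v.1,
   v.2.1,
   a2 * a4 + a1 * a3 - v.2.1 * (a1 * a2 + a3 * a4 - v.2.1 * v.2.2 - v.1) - v.2.2)

/-- The braid group generator τ₃ acting on trace coordinates. -/
def tau3 (a1 a2 a3 a4 : ℂ) (v : ℂ × ℂ × ℂ) : ℂ × ℂ × ℂ :=
  (a1 * a2 + a3 * a4 - v.2.2 * (a2 * a3 + a1 * a4 - v.2.2 * v.1 - v.2.1) - v.1,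
   a2 * a3 + a1 * a4 - v.2.2 * v.1 - v.2.1,
   v.2.2)

/-- The polynomial `fpoly` is invariant under `tau3`, a composite of two Vieta involutions. -/
theorem fpoly_tau3 (a1 a2 a3 a4 : ℂ) (v : ℂ × ℂ × ℂ) :
    fpoly a1 a2 a3 a4 (tau3 a1 a2 a3 a4 v) = fpoly a1 a2 a3 a4 v := by
  simp only [fpoly, tau3]
  ring

/-- The braid generator τ3 maps the relative character variety
`M_a = {v : fpoly a v = 0}` into itself. -/
theorem tau (a1 a2 a3 a4 : ℂ) (v : ℂ × ℂ × ℂ)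
    (h : fpoly a1 a2 a3 a4 v = 0) :
    fpoly a1 a2 a3 a4 (tau3 a1 a2 a3 a4 v) = 0 := by
  rw [fpoly_tau3, h]
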